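/- arXiv:2012.04321 — 2 statements merged into one kernel-verified Lean document; each statement's English description precedes it below -/
import Mathlib

section
/- Let σ₁ and σ₂ be 3×3 density matrices whose eigenvalue vectors satisfy λ(σ₁) ≺ λ(σ₂). Then there exists a unitary U on ℂ³⊗ℂ³ such that both marginals of U(σ₂⊗σ₂)U† equal σ₁, i.e., Tr_B(U(σ₂⊗σ₂)U†) = Tr_A(U(σ₂⊗σ₂)U†) = σ₁. -/
open Matrix Kronecker ComplexOrder

/-- The sum of the `k` largest entries of `v`, as the supremum of sums over
subsets of cardinality `k`. -/
noncomputable def kMaxSum {n : ℕ} (v : Fin n → ℝ) (k : ℕ) : ℝ :=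
  sSup ((fun s : Finset (Fin n) => ∑ i ∈ s, v i) '' {s : Finset (Fin n) | s.card = k})

/-- `IsMajorizedBy v w` means `v ≺ w` : for every `k ≤ n` the sum of the `k` largest
entries of `v` is at most that of `w`, with equal total sums. -/
def IsMajorizedBy {n : ℕ} (v w : Fin n → ℝ) : Prop :=
  (∀ k : ℕ, k ≤ n → kMaxSum v k ≤ kMaxSum w k) ∧ ∑ i, v i = ∑ i, w i

/-- Partial trace over the second tensor factor. -/
noncomputable def ptraceRight {n m : Type*} [Fintype m]
    (X : Matrix (n × m) (n × m) ℂ) : Matrix n n ℂ :=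
  Matrix.of fun i i' => ∑ j, X (i, j) (i', j)

/-- Partial trace over the first tensor factor. -/
noncomputable def ptraceLeft {n m : Type*} [Fintype n]
    (X : Matrix (n × m) (n × m) ℂ) : Matrix m m ℂ :=
  Matrix.of fun j j' => ∑ i, X (i, j) (i, j')


/-- Core of the 3-dimensional Schur–Horn theorem: two plane rotations. -/
lemma horn_core (p q : Fin 3 → ℝ) (i j k : Fin 3) (hs : q 0 + q 1 + q 2 = p i + p j + p k)
    (h1 : p j ≤ q 0) (h2 : q 0 ≤ p i)
    (h3 : (p k ≤ q 1 ∧ q 1 ≤ p i + p j - q 0) ∨ (p i + p j - q 0 ≤ q 1 ∧ q 1 ≤ p k)) :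
    ∃ W : Matrix (Fin 3) (Fin 3) ℝ, W * Wᵀ = 1 ∧
      ∀ a, q a = (W a 0)^2 * p i + (W a 1)^2 * p j + (W a 2)^2 * p k := by
  have key : ∀ x y z : ℝ, (x ≤ z ∧ z ≤ y) ∨ (y ≤ z ∧ z ≤ x) →
      ∃ c s : ℝ, c^2 + s^2 = 1 ∧ z = c^2 * y + s^2 * x := by
    intro x y z h
    by_cases hxy : x = y
    · subst hxy
      exact ⟨1, 0, by norm_num, by rcases h with h | h <;> linarith [h.1, h.2]⟩
    · have hne : y - x ≠ 0 := fun h => hxy (by linarith)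
      have ht0 : 0 ≤ (z - x) / (y - x) := by
        rcases h with h | h
        · exact div_nonneg (by linarith) (by linarith)
        · exact div_nonneg_of_nonpos (by linarith) (by linarith)
      have ht1 : 0 ≤ (y - z) / (y - x) := by
        rcases h with h | h
        · exact div_nonneg (by linarith) (by linarith)
        · exact div_nonneg_of_nonpos (by linarith) (by linarith)
      refine ⟨√((z - x) / (y - x)), √((y - z) / (y - x)), ?_, ?_⟩
      · rw [Real.sq_sqrt ht0, Real.sq_sqrt ht1]; field_simp; ring
      · rw [Real.sq_sqrt ht0, Real.sq_sqrt ht1]; field_simp; ring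
  obtain ⟨c, s, hcs, hq0⟩ := key (p j) (p i) (q 0) (Or.inl ⟨h1, h2⟩)
  obtain ⟨C, S, hCS, hq1⟩ := key (p k) (p i + p j - q 0) (q 1) h3
  refine ⟨!![c, s, 0; -s*C, c*C, S; s*S, -c*S, C], ?_, ?_⟩
  · ext a b
    fin_cases a <;> fin_cases b <;> simp [Matrix.mul_apply, Fin.sum_univ_three]
    · linear_combination hcs
    · ring
    · ring
    · ring
    · linear_combination C^2 * hcs + hCS
    · linear_combination (-C*S) * hcs
    · ring
    · linear_combination (-C*S) * hcs
    · linear_combination S^2 * hcs + hCS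
  · intro a
    fin_cases a <;> simp
    · linear_combination hq0
    · linear_combination hq1 - C^2 * hq0 - C^2 * (p i + p j) * hcs
    · linear_combination hs - hq1 - hq0 + C^2 * hq0 - (1 - C^2) * (p i + p j) * hcs - p k * hCS +
        (- s^2 * p i - c^2 * p j) * hCS

lemma horn (p q : Fin 3 → ℝ) (hs : ∑ i, q i = ∑ i, p i)
    (hu : ∀ a, ∃ b, q a ≤ p b) (hl : ∀ a, ∃ b, p b ≤ q a) :
    ∃ W : Matrix (Fin 3) (Fin 3) ℝ, W * Wᵀ = 1 ∧ ∀ a, q a = ∑ b, (W a b)^2 * p b := by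
  obtain ⟨e, he⟩ : ∃ e : Equiv.Perm (Fin 3), Monotone (p ∘ e) := ⟨Tuple.sort p, Tuple.monotone_sort p⟩
  have h01 : p (e 0) ≤ p (e 1) := he (by decide)
  have h12 : p (e 1) ≤ p (e 2) := he (by decide)
  have hall : ∀ b, p (e 0) ≤ p b ∧ p b ≤ p (e 2) := by
    intro b
    obtain ⟨c, rfl⟩ := e.surjective b
    exact ⟨he (Fin.zero_le c), he (Fin.le_last c)⟩
  have hu' : ∀ a, q a ≤ p (e 2) := fun a => by
    obtain ⟨b, hb⟩ := hu a; exact hb.trans (hall b).2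
  have hl' : ∀ a, p (e 0) ≤ q a := fun a => by
    obtain ⟨b, hb⟩ := hl a; exact (hall b).1.trans hb
  have hs' : q 0 + q 1 + q 2 = p (e 0) + p (e 1) + p (e 2) := by
    have : ∑ i, p i = ∑ i, p (e i) := (Equiv.sum_comp e p).symm
    rw [this, Fin.sum_univ_three, Fin.sum_univ_three] at hs
    exact hs
  have main : ∃ f : Equiv.Perm (Fin 3), ∃ W : Matrix (Fin 3) (Fin 3) ℝ, W * Wᵀ = 1 ∧
      ∀ a, q a = (W a 0)^2 * p (f 0) + (W a 1)^2 * p (f 1) + (W a 2)^2 * p (f 2) := by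
    have := hu' 0; have := hu' 1; have := hu' 2
    have := hl' 0; have := hl' 1; have := hl' 2
    by_cases hc : p (e 1) ≤ q 0
    · refine ⟨(Equiv.swap 0 2).trans e, ?_⟩
      have e0 : ((Equiv.swap 0 2).trans e) 0 = e 2 := by simp
      have e1 : ((Equiv.swap 0 2).trans e) 1 = e 1 := by
        simp [Equiv.swap_apply_of_ne_of_ne]
      have e2 : ((Equiv.swap 0 2).trans e) 2 = e 0 := by simp
      rw [e0, e1, e2]
      exact horn_core p q (e 2) (e 1) (e 0) (by linarith) hc (by linarith)
        (Or.inl ⟨by linarith, by linarith⟩)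
    · push Not at hc
      refine ⟨(Equiv.swap 0 1).trans e, ?_⟩
      have e0 : ((Equiv.swap 0 1).trans e) 0 = e 1 := by simp
      have e1 : ((Equiv.swap 0 1).trans e) 1 = e 0 := by simp
      have e2 : ((Equiv.swap 0 1).trans e) 2 = e 2 := by
        simp [Equiv.swap_apply_of_ne_of_ne]
      rw [e0, e1, e2]
      exact horn_core p q (e 1) (e 0) (e 2) (by linarith) (by linarith) hc.le
        (Or.inr ⟨by linarith, by linarith⟩)
  obtain ⟨f, W, hW, hq⟩ := main
  refine ⟨W.submatrix id f.symm, ?_, ?_⟩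
  · rw [Matrix.transpose_submatrix, Matrix.submatrix_mul_equiv, hW]; simp
  · intro a
    rw [← Equiv.sum_comp f, Fin.sum_univ_three, hq a]
    simp

lemma kMaxSum_bdd {n : ℕ} (v : Fin n → ℝ) (k : ℕ) : 
    ((fun s : Finset (Fin n) => ∑ i ∈ s, v i) '' {s : Finset (Fin n) | s.card = k}).Finite :=
  (Set.toFinite _).image _

lemma le_kMaxSum {n : ℕ} (v : Fin n → ℝ) (s : Finset (Fin n)) : ∑ i ∈ s, v i ≤ kMaxSum v s.card :=
  le_csSup (kMaxSum_bdd v _).bddAbove ⟨s, rfl, rfl⟩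

lemma exists_kMaxSum {n : ℕ} (v : Fin n → ℝ) (k : ℕ) (hk : k ≤ n) :
    ∃ s : Finset (Fin n), s.card = k ∧ ∑ i ∈ s, v i = kMaxSum v k := by
  have hne : ((fun s : Finset (Fin n) => ∑ i ∈ s, v i) ''
      {s : Finset (Fin n) | s.card = k}).Nonempty := by
    obtain ⟨s, _, hs⟩ := Finset.exists_subset_card_eq (s := (Finset.univ : Finset (Fin n)))
      (n := k) (by simpa using hk)
    exact ⟨_, s, hs, rfl⟩
  obtain ⟨s, hs, h⟩ := hne.csSup_mem (kMaxSum_bdd v k)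
  exact ⟨s, hs, h⟩

lemma horn_maj (p q : Fin 3 → ℝ) (h : IsMajorizedBy q p) :
    ∃ W : Matrix (Fin 3) (Fin 3) ℝ, W * Wᵀ = 1 ∧ ∀ a, q a = ∑ b, (W a b)^2 * p b := by
  refine horn p q h.2 (fun a => ?_) (fun a => ?_)
  · obtain ⟨s, hs, hv⟩ := exists_kMaxSum p 1 (by norm_num)
    obtain ⟨b, rfl⟩ := Finset.card_eq_one.1 hs
    have h1 := le_kMaxSum q {a}
    have h2 := h.1 1 (by norm_num)
    simp at h1 hv
    exact ⟨b, by linarith⟩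
  · obtain ⟨s, hs, hv⟩ := exists_kMaxSum p 2 (by norm_num)
    have hsc : sᶜ.card = 1 := by rw [Finset.card_compl, hs]; rfl
    obtain ⟨b, hb⟩ := Finset.card_eq_one.1 hsc
    have h1 := le_kMaxSum q {a}ᶜ
    have hc : ({a}ᶜ : Finset (Fin 3)).card = 2 := by rw [Finset.card_compl]; rfl
    rw [hc] at h1
    have h2 := h.1 2 (by norm_num)
    have h3 := Finset.sum_add_sum_compl s p
    have h4 := Finset.sum_add_sum_compl {a} q
    rw [hb] at h3
    have h5 := h.2
    simp only [Finset.sum_singleton] at h3 h4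
    exact ⟨b, by linarith⟩

lemma ptraceRight_conj (A B : Matrix (Fin 3) (Fin 3) ℂ) (hB : Bᴴ * B = 1)
    (X : Matrix (Fin 3 × Fin 3) (Fin 3 × Fin 3) ℂ) :
    ptraceRight ((A ⊗ₖ B) * X * (A ⊗ₖ B)ᴴ) = A * ptraceRight X * Aᴴ := by
  have hb : ∀ d d', ∑ j, B j d * star (B j d') = if d = d' then 1 else 0 := by
    intro d d'
    have := congrFun (congrFun hB d') d
    rw [Matrix.mul_apply, Matrix.one_apply] at this
    simp only [Matrix.conjTranspose_apply] at this
    simp only [eq_comm (a := d), ← this, mul_comm]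
  ext i i'
  simp only [ptraceRight, Matrix.of_apply, Matrix.mul_apply, Matrix.conjTranspose_apply,
    Matrix.kroneckerMap_apply, Fintype.sum_prod_type, Finset.sum_mul, Finset.mul_sum, star_mul']
  calc _ = ∑ c', ∑ d', ∑ c, ∑ d, ∑ j, A i c * B j d * X (c, d) (c', d') *
        (star (A i' c') * star (B j d')) := by
        rw [Finset.sum_comm]; refine Finset.sum_congr rfl fun c' _ => ?_
        rw [Finset.sum_comm]; refine Finset.sum_congr rfl fun d' _ => ?_
        rw [Finset.sum_comm]; refine Finset.sum_congr rfl fun c _ => ?_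
        rw [Finset.sum_comm]
    _ = ∑ c', ∑ d', ∑ c, ∑ d, A i c * X (c, d) (c', d') * star (A i' c') *
          (if d = d' then 1 else 0) := by
        refine Finset.sum_congr rfl fun c' _ => Finset.sum_congr rfl fun d' _ =>
          Finset.sum_congr rfl fun c _ => Finset.sum_congr rfl fun d _ => ?_
        rw [← hb, Finset.mul_sum]
        exact Finset.sum_congr rfl fun j _ => by ring
    _ = _ := by
        simp only [mul_ite, mul_one, mul_zero, Finset.sum_ite_eq', Finset.sum_ite_eq,
          Finset.mem_univ, if_true]
        refine Finset.sum_congr rfl fun c' _ => ?_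
        rw [Finset.sum_comm]

lemma ptraceLeft_eq (X : Matrix (Fin 3 × Fin 3) (Fin 3 × Fin 3) ℂ) :
    ptraceLeft X = ptraceRight (X.submatrix Prod.swap Prod.swap) := rfl

lemma ptraceLeft_conj (A B : Matrix (Fin 3) (Fin 3) ℂ) (hA : Aᴴ * A = 1)
    (X : Matrix (Fin 3 × Fin 3) (Fin 3 × Fin 3) ℂ) :
    ptraceLeft ((A ⊗ₖ B) * X * (A ⊗ₖ B)ᴴ) = B * ptraceLeft X * Bᴴ := by
  rw [ptraceLeft_eq, ptraceLeft_eq, ← ptraceRight_conj B A hA]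
  congr 1
  have h : (B ⊗ₖ A) = (A ⊗ₖ B).submatrix (Equiv.prodComm _ _) (Equiv.prodComm _ _) := by
    ext ⟨a, b⟩ ⟨c, d⟩; simp [mul_comm]
  rw [h, Matrix.conjTranspose_submatrix]
  change _ = _ * X.submatrix (Equiv.prodComm _ _) (Equiv.prodComm _ _) * _
  rw [Matrix.submatrix_mul_equiv, Matrix.submatrix_mul_equiv]
  rfl

/-- Relabelling of pairs: `(i,i)`, `(i+1,i+2)`, `(i+2,i+1)` correspond to `i` in three blocks. -/
def blockEquiv : Fin 3 × Fin 3 ≃ Fin 3 × Fin 3 where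
  toFun x := (-x.1 - x.2, x.2 - x.1)
  invFun y := (y.1 + y.2, y.1 - y.2)
  left_inv := by decide
  right_inv := by decide

lemma blockEquiv_symm (y : Fin 3 × Fin 3) : blockEquiv.symm y = (y.1 + y.2, y.1 - y.2) := rfl

lemma diag_case (p q : Fin 3 → ℝ) (hp : ∑ i, p i = 1) (W : Matrix (Fin 3) (Fin 3) ℝ)
    (hW : W * Wᵀ = 1) (hq : ∀ a, q a = ∑ b, (W a b)^2 * p b) :
    ∃ U ∈ Matrix.unitaryGroup (Fin 3 × Fin 3) ℂ, ∀ D : Matrix (Fin 3 × Fin 3) (Fin 3 × Fin 3) ℂ,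
      D = (diagonal fun i => (p i : ℂ)) ⊗ₖ (diagonal fun i => (p i : ℂ)) →
      ptraceRight (U * D * Uᴴ) = diagonal (fun i => (q i : ℂ)) ∧
      ptraceLeft (U * D * Uᴴ) = diagonal (fun i => (q i : ℂ)) := by
  set V : Matrix (Fin 3) (Fin 3) ℂ := W.map Complex.ofReal with hV
  have hVV : V * Vᴴ = 1 := by
    have : Vᴴ = (Wᵀ).map Complex.ofReal := by
      ext a b; simp [hV]
    have h2 : (W * Wᵀ).map Complex.ofRealHom = W.map Complex.ofRealHom * (Wᵀ).map Complex.ofRealHom :=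
      Matrix.map_mul
    rw [this, hV]
    refine h2.symm.trans ?_
    rw [hW]
    ext a b; simp only [Matrix.map_apply, Matrix.one_apply]; split_ifs <;> simp
  set U := (V ⊗ₖ (1 : Matrix (Fin 3) (Fin 3) ℂ)).submatrix blockEquiv blockEquiv with hU
  have hcol : ∀ l, (W 0 l)^2 + (W 1 l)^2 + (W 2 l)^2 = 1 := by
    intro l
    have h := congrArg (fun M => M l l) (mul_eq_one_comm.1 hW)
    simp [Matrix.mul_apply, Fin.sum_univ_three] at h
    linarith
  have hrow : ∀ l, (W l 0)^2 + (W l 1)^2 + (W l 2)^2 = 1 := by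
    intro l
    have h := congrArg (fun M => M l l) hW
    simp [Matrix.mul_apply, Fin.sum_univ_three] at h
    linarith
  refine ⟨U, ?_, ?_⟩
  · rw [Matrix.mem_unitaryGroup_iff, Matrix.star_eq_conjTranspose, hU,
      Matrix.conjTranspose_submatrix, Matrix.submatrix_mul_equiv, Matrix.conjTranspose_kronecker,
      ← Matrix.mul_kronecker_mul, hVV]
    simp
  · rintro D rfl
    have hent : ∀ x y, (U * ((diagonal fun i => (p i : ℂ)) ⊗ₖ (diagonal fun i => (p i : ℂ))) * Uᴴ) x y
        = if (blockEquiv x).2 = (blockEquiv y).2 then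
            ((∑ l, W (blockEquiv x).1 l * W (blockEquiv y).1 l *
              (p (l + (blockEquiv x).2) * p (l - (blockEquiv x).2)) : ℝ) : ℂ) else 0 := by
      intro x y
      rw [Matrix.diagonal_kronecker_diagonal, Matrix.mul_apply]
      simp only [Matrix.mul_diagonal]
      rw [← Equiv.sum_comp blockEquiv.symm, Fintype.sum_prod_type]
      simp only [hU, hV, Matrix.submatrix_apply, Matrix.conjTranspose_apply, Equiv.apply_symm_apply,
        Matrix.kroneckerMap_apply, Matrix.one_apply, Matrix.map_apply]
      simp only [blockEquiv_symm]
      generalize blockEquiv x = x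
      generalize blockEquiv y = y
      obtain ⟨x1, x2⟩ := x
      obtain ⟨y1, y2⟩ := y
      simp only
      by_cases h : x2 = y2
      · subst h
        simp only [if_true]
        push_cast
        refine Finset.sum_congr rfl fun l _ => ?_
        simp
        ring
      · rw [if_neg h]
        apply Finset.sum_eq_zero; intro l _
        apply Finset.sum_eq_zero; intro k _
        by_cases h1 : x2 = k
        · have : ¬ (y2 = k) := fun h2 => h (h1.trans h2.symm)
          simp [this]
        · simp [h1]
    have hp' : p 0 + p 1 + p 2 = 1 := by rw [← hp, Fin.sum_univ_three]
    have key : ∀ a b c : Fin 3, (W a 0)^2 + (W b 0)^2 + (W c 0)^2 = 1 → 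
      (W a 1)^2 + (W b 1)^2 + (W c 1)^2 = 1 → (W a 2)^2 + (W b 2)^2 + (W c 2)^2 = 1 → 
      q a = ∑ l, (W a l)^2 * (p l * p l) + ((W b 0)^2 + (W c 0)^2) * (p 1 * p 2) + 
        ((W b 1)^2 + (W c 1)^2) * (p 2 * p 0) + ((W b 2)^2 + (W c 2)^2) * (p 0 * p 1) := by
      intro a b c h0 h1 h2
      rw [hq a, Fin.sum_univ_three, Fin.sum_univ_three]
      linear_combination (-(W a 0)^2 * p 0 - (W a 1)^2 * p 1 - (W a 2)^2 * p 2) * hp'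
        - (p 1 * p 2) * h0 - (p 2 * p 0) * h1 - (p 0 * p 1) * h2
        + (p 0 * p 1 + p 1 * p 2 + p 2 * p 0) * hrow a
    have k0 := key 0 1 2 (by linarith [hcol 0]) (by linarith [hcol 1]) (by linarith [hcol 2])
    have k1 := key 1 2 0 (by linarith [hcol 0]) (by linarith [hcol 1]) (by linarith [hcol 2])
    have k2 := key 2 0 1 (by linarith [hcol 0]) (by linarith [hcol 1]) (by linarith [hcol 2])
    have b00 : blockEquiv (0, 0) = (0, 0) := by decide
    have b11 : blockEquiv (1, 1) = (1, 0) := by decide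
    have b22 : blockEquiv (2, 2) = (2, 0) := by decide
    have b01 : blockEquiv (0, 1) = (2, 1) := by decide
    have b12 : blockEquiv (1, 2) = (0, 1) := by decide
    have b20 : blockEquiv (2, 0) = (1, 1) := by decide
    have b02 : blockEquiv (0, 2) = (1, 2) := by decide
    have b10 : blockEquiv (1, 0) = (2, 2) := by decide
    have b21 : blockEquiv (2, 1) = (0, 2) := by decide
    have s11 : (1 + 1 : Fin 3) = 2 := by decide
    have s12 : (1 + 2 : Fin 3) = 0 := by decide
    have s21 : (2 + 1 : Fin 3) = 0 := by decide
    have s22 : (2 + 2 : Fin 3) = 1 := by decide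
    have m01 : (0 - 1 : Fin 3) = 2 := by decide
    have m02 : (0 - 2 : Fin 3) = 1 := by decide
    have m12 : (1 - 2 : Fin 3) = 2 := by decide
    have m21 : (2 - 1 : Fin 3) = 1 := by decide
    rw [Fin.sum_univ_three] at k0 k1 k2
    constructor
    · ext i j
      fin_cases i <;> fin_cases j <;>
        simp only [Fin.zero_eta, Fin.mk_one, Fin.reduceFinMk, ptraceRight, Matrix.of_apply,
          Fin.sum_univ_three, hent, b00, b01, b02, b10, b11, b12, b20, b21, b22, s11, s12, s21, s22,
          m01, m02, m12, m21, zero_add, add_zero, sub_zero, sub_self, Matrix.diagonal_apply,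
          Fin.reduceEq, if_true, if_false, k0, k1, k2] <;> push_cast <;> ring
    · ext i j
      fin_cases i <;> fin_cases j <;>
        simp only [Fin.zero_eta, Fin.mk_one, Fin.reduceFinMk, ptraceLeft, Matrix.of_apply,
          Fin.sum_univ_three, hent, b00, b01, b02, b10, b11, b12, b20, b21, b22, s11, s12, s21, s22,
          m01, m02, m12, m21, zero_add, add_zero, sub_zero, sub_self, Matrix.diagonal_apply,
          Fin.reduceEq, if_true, if_false, k0, k1, k2] <;> push_cast <;> ring

theorem equal_marginals_from_majorization_dim3
    (σ1 σ2 : Matrix (Fin 3) (Fin 3) ℂ)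
    (h1 : σ1.PosSemidef) (ht1 : σ1.trace = 1)
    (h2 : σ2.PosSemidef) (ht2 : σ2.trace = 1)
    (hmaj : IsMajorizedBy h1.isHermitian.eigenvalues h2.isHermitian.eigenvalues) :
    ∃ U ∈ Matrix.unitaryGroup (Fin 3 × Fin 3) ℂ,
      ptraceRight (U * (σ2 ⊗ₖ σ2) * Uᴴ) = σ1 ∧
      ptraceLeft (U * (σ2 ⊗ₖ σ2) * Uᴴ) = σ1 := by
  obtain ⟨W, hW, hq⟩ := horn_maj _ _ hmaj
  have hp : ∑ i, h2.isHermitian.eigenvalues i = 1 := by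
    have h := h2.isHermitian.trace_eq_sum_eigenvalues
    rw [ht2] at h
    have h' : ((∑ i, h2.isHermitian.eigenvalues i : ℝ) : ℂ) = ((1 : ℝ) : ℂ) := by
      push_cast; exact h.symm
    exact Complex.ofReal_injective h'
  obtain ⟨U, hU, hD⟩ := diag_case _ _ hp W hW hq
  have spec : ∀ (σ : Matrix (Fin 3) (Fin 3) ℂ) (h : σ.IsHermitian), ∃ V : Matrix (Fin 3) (Fin 3) ℂ,
      Vᴴ * V = 1 ∧ V * Vᴴ = 1 ∧ σ = V * diagonal (fun i => (h.eigenvalues i : ℂ)) * Vᴴ := by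
    intro σ h
    refine ⟨h.eigenvectorUnitary, ?_, ?_, ?_⟩
    · exact Matrix.mem_unitaryGroup_iff'.1 h.eigenvectorUnitary.2
    · exact Matrix.mem_unitaryGroup_iff.1 h.eigenvectorUnitary.2
    · have := h.spectral_theorem
      rw [Unitary.conjStarAlgAut_apply] at this
      exact this
  obtain ⟨V1, hV1, hV1', e1⟩ := spec σ1 h1.isHermitian
  obtain ⟨V2, hV2, hV2', e2⟩ := spec σ2 h2.isHermitian
  obtain ⟨hR, hL⟩ := hD _ rfl
  have hUU : U * Uᴴ = 1 := Matrix.mem_unitaryGroup_iff.1 hU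
  have e3 : (V2ᴴ ⊗ₖ V2ᴴ) * (σ2 ⊗ₖ σ2) * (V2ᴴ ⊗ₖ V2ᴴ)ᴴ =
      (diagonal fun i => (h2.isHermitian.eigenvalues i : ℂ)) ⊗ₖ
      (diagonal fun i => (h2.isHermitian.eigenvalues i : ℂ)) := by
    have : V2ᴴ * σ2 * V2 = diagonal fun i => (h2.isHermitian.eigenvalues i : ℂ) := by
      conv_lhs => rw [e2]
      calc _ = (V2ᴴ * V2) * diagonal (fun i => (h2.isHermitian.eigenvalues i : ℂ)) * (V2ᴴ * V2) := by
            simp only [Matrix.mul_assoc]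
        _ = _ := by rw [hV2]; simp
    rw [Matrix.conjTranspose_kronecker, Matrix.conjTranspose_conjTranspose,
      ← Matrix.mul_kronecker_mul, ← Matrix.mul_kronecker_mul, this]
  have e4 : ((V1 ⊗ₖ V1) * U * (V2ᴴ ⊗ₖ V2ᴴ)) * (σ2 ⊗ₖ σ2) * ((V1 ⊗ₖ V1) * U * (V2ᴴ ⊗ₖ V2ᴴ))ᴴ =
      (V1 ⊗ₖ V1) * (U * ((diagonal fun i => (h2.isHermitian.eigenvalues i : ℂ)) ⊗ₖ
      (diagonal fun i => (h2.isHermitian.eigenvalues i : ℂ))) * Uᴴ) * (V1 ⊗ₖ V1)ᴴ := by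
    rw [← e3, Matrix.conjTranspose_mul, Matrix.conjTranspose_mul]
    simp only [Matrix.mul_assoc]
  refine ⟨(V1 ⊗ₖ V1) * U * (V2ᴴ ⊗ₖ V2ᴴ), ?_, ?_, ?_⟩
  · refine mul_mem (mul_mem ?_ hU) ?_
    · rw [Matrix.mem_unitaryGroup_iff, Matrix.star_eq_conjTranspose,
        Matrix.conjTranspose_kronecker, ← Matrix.mul_kronecker_mul, hV1']
      simp
    · rw [Matrix.mem_unitaryGroup_iff, Matrix.star_eq_conjTranspose,
        Matrix.conjTranspose_kronecker, ← Matrix.mul_kronecker_mul,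
        Matrix.conjTranspose_conjTranspose, hV2]
      simp
  · rw [e4, ptraceRight_conj _ _ hV1, hR]
    exact e1.symm
  · rw [e4, ptraceLeft_conj _ _ hV1, hL]
    exact e1.symm
end

section
/- Let E_0 ≤ E_1 ≤ E_2 ≤ E_3 be real numbers whose successive gaps δ_i = E_{i+1} − E_i are nonincreasing (δ_0 ≥ δ_1 ≥ δ_2), and let 0 ≤ β' ≤ β. For i ∈ {1,2} define r_i(γ) ∈ ℝ⁴ by (r_i(γ))_j = p_j(γ)·p_{j+i mod 4}(γ), where p(γ) is the Gibbs vector at inverse temperature γ, and write ‖v‖ = ∑_j v_j. Then for i = 1, 2: (a) r_0(β)/‖r_0(β)‖ majorizes (𝟙+Π^i) r_i(β')/(2‖r_i(β')‖), where Π is the 4×4 cyclic permutation matrix and r_0(γ)_j = p_j(γ)²; and (b) ‖r_i(β)‖ ≤ ‖r_i(β')‖. -/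
/-- The Gibbs probability vector of energies `E` at inverse temperature `β`. -/
noncomputable def gibbs {d : ℕ} (E : Fin d → ℝ) (β : ℝ) : Fin d → ℝ :=
  fun i => Real.exp (-(β * E i)) / ∑ j, Real.exp (-(β * E j))

/-- The cyclic permutation matrix `Π` with `Π i j = 1` iff `i ≡ j + 1 (mod n)`. -/
def cyc (n : ℕ) : Matrix (Fin n) (Fin n) ℝ :=
  Matrix.of fun i j => if (i : ℕ) = ((j : ℕ) + 1) % n then 1 else 0


lemma kMaxSum_le_of {v w : Fin 4 → ℝ} (k : ℕ) (hk : k ≤ 4)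
    (h : ∀ s : Finset (Fin 4), s.card = k → ∃ t : Finset (Fin 4), t.card = k ∧
      ∑ i ∈ s, v i ≤ ∑ i ∈ t, w i) : kMaxSum v k ≤ kMaxSum w k := by
  unfold kMaxSum
  apply csSup_le
  · obtain ⟨s, -, hs⟩ := Finset.exists_subset_card_eq (s := (Finset.univ : Finset (Fin 4)))
      (n := k) (by simpa using hk)
    exact ⟨_, s, hs, rfl⟩
  · rintro _ ⟨s, hs, rfl⟩
    obtain ⟨t, ht, hle⟩ := h s hs
    refine le_trans hle (le_csSup ?_ ⟨t, ht, rfl⟩)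
    exact ((Set.toFinite _).image _).bddAbove

lemma maj_of {v w : Fin 4 → ℝ} (h1 : ∀ j, v j ≤ w 0)
    (h2 : ∀ j l, j ≠ l → v j + v l ≤ w 0 + w 1)
    (h3 : ∀ j, w 3 ≤ v j) (ht : ∑ i, v i = ∑ i, w i) : IsMajorizedBy v w := by
  refine ⟨fun k hk => kMaxSum_le_of k hk ?_, ht⟩
  intro s hs
  interval_cases k
  · rw [Finset.card_eq_zero] at hs
    subst hs
    exact ⟨∅, rfl, by simp⟩
  · obtain ⟨j, rfl⟩ := Finset.card_eq_one.1 hs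
    exact ⟨{0}, rfl, by simpa using h1 j⟩
  · obtain ⟨j, l, hjl, rfl⟩ := Finset.card_eq_two.1 hs
    refine ⟨{0, 1}, rfl, ?_⟩
    rw [Finset.sum_pair hjl, Finset.sum_pair (by decide)]
    exact h2 j l hjl
  · have hc : sᶜ.card = 1 := by rw [Finset.card_compl, hs]; rfl
    obtain ⟨j, hj⟩ := Finset.card_eq_one.1 hc
    refine ⟨{3}ᶜ, rfl, ?_⟩
    have e1 := Finset.sum_add_sum_compl s v
    have e2 := Finset.sum_add_sum_compl ({3} : Finset (Fin 4)) w
    rw [hj] at e1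
    rw [Finset.sum_singleton] at e1 e2
    linarith [h3 j]
  · have : s = Finset.univ := Finset.card_eq_iff_eq_univ s |>.1 (by simpa using hs)
    subst this
    exact ⟨Finset.univ, rfl, ht.le⟩

/-- Prefix sums of normalised squares grow with inverse temperature. -/
lemma sq_step {p0 p1 p2 p3 q0 q1 q2 q3 : ℝ} (hp0 : 0 < p0) (hp1 : 0 < p1) (hp2 : 0 < p2)
    (hp3 : 0 < p3) (hq0 : 0 < q0) (hq1 : 0 < q1) (hq2 : 0 < q2) (hq3 : 0 < q3)
    (h01 : q1 * p0 ≤ q0 * p1) (h02 : q2 * p0 ≤ q0 * p2) (h03 : q3 * p0 ≤ q0 * p3)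
    (h12 : q2 * p1 ≤ q1 * p2) (h13 : q3 * p1 ≤ q1 * p3) (h23 : q3 * p2 ≤ q2 * p3) :
    p0 ^ 2 / (p0 ^ 2 + p1 ^ 2 + p2 ^ 2 + p3 ^ 2) ≤ q0 ^ 2 / (q0 ^ 2 + q1 ^ 2 + q2 ^ 2 + q3 ^ 2) ∧
    (p0 ^ 2 + p1 ^ 2) / (p0 ^ 2 + p1 ^ 2 + p2 ^ 2 + p3 ^ 2) ≤
      (q0 ^ 2 + q1 ^ 2) / (q0 ^ 2 + q1 ^ 2 + q2 ^ 2 + q3 ^ 2) ∧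
    q3 ^ 2 / (q0 ^ 2 + q1 ^ 2 + q2 ^ 2 + q3 ^ 2) ≤
      p3 ^ 2 / (p0 ^ 2 + p1 ^ 2 + p2 ^ 2 + p3 ^ 2) := by
  have g01 := pow_le_pow_left₀ (by positivity) h01 2
  have g02 := pow_le_pow_left₀ (by positivity) h02 2
  have g03 := pow_le_pow_left₀ (by positivity) h03 2
  have g12 := pow_le_pow_left₀ (by positivity) h12 2
  have g13 := pow_le_pow_left₀ (by positivity) h13 2
  have g23 := pow_le_pow_left₀ (by positivity) h23 2
  simp only [mul_pow] at *
  refine ⟨?_, ?_, ?_⟩ <;> rw [div_le_div_iff₀ (by positivity) (by positivity)] <;> linarith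

/-- The case `i = 1`, at a fixed temperature. -/
lemma case1 {p0 p1 p2 p3 : ℝ} (hp0 : 0 < p0) (hp1 : 0 < p1) (hp2 : 0 < p2)
    (hp3 : 0 < p3) (h01 : p1 ≤ p0) (h12 : p2 ≤ p1) (h23 : p3 ≤ p2)
    (c1 : p1 ^ 2 ≤ p0 * p2) (c3 : p1 * p2 ≤ p0 * p3) :
    p0 / (2 * (p0 + p2)) ≤ p0 ^ 2 / (p0 ^ 2 + p1 ^ 2 + p2 ^ 2 + p3 ^ 2) ∧
    p0 / (2 * (p0 + p2)) + p1 / (2 * (p1 + p3)) ≤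
      (p0 ^ 2 + p1 ^ 2) / (p0 ^ 2 + p1 ^ 2 + p2 ^ 2 + p3 ^ 2) ∧
    p3 ^ 2 / (p0 ^ 2 + p1 ^ 2 + p2 ^ 2 + p3 ^ 2) ≤ p2 / (2 * (p0 + p2)) := by
  refine ⟨?_, ?_, ?_⟩
  · rw [div_le_div_iff₀ (by positivity) (by positivity)]
    have : p0 ^ 2 + p1 ^ 2 + p2 ^ 2 + p3 ^ 2 ≤ p0 * (2 * (p0 + p2)) := by nlinarith
    nlinarith
  · have a1 : p0 / (2 * (p0 + p2)) ≤ p0 ^ 2 / (2 * (p0 ^ 2 + p2 ^ 2)) := by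
      rw [div_le_div_iff₀ (by positivity) (by positivity)]
      have : 0 ≤ p0 * p2 * (p0 - p2) := mul_nonneg (by positivity) (by linarith)
      nlinarith
    have a2 : p1 / (2 * (p1 + p3)) ≤ p1 ^ 2 / (2 * (p1 ^ 2 + p3 ^ 2)) := by
      rw [div_le_div_iff₀ (by positivity) (by positivity)]
      have : 0 ≤ p1 * p3 * (p1 - p3) := mul_nonneg (by positivity) (by linarith)
      nlinarith
    refine (add_le_add a1 a2).trans ?_
    have k1 : (p1 * p2) ^ 2 ≤ (p0 * p3) ^ 2 := pow_le_pow_left₀ (by positivity) c3 2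
    have k2 : p1 ^ 2 + p3 ^ 2 ≤ p0 ^ 2 + p2 ^ 2 := by
      have := pow_le_pow_left₀ hp1.le h01 2
      have := pow_le_pow_left₀ hp3.le h23 2
      linarith
    rw [div_add_div _ _ (by positivity) (by positivity),
      div_le_div_iff₀ (by positivity) (by positivity)]
    have := mul_nonneg (sub_nonneg.2 k1) (sub_nonneg.2 k2)
    nlinarith
  · rw [div_le_div_iff₀ (by positivity) (by positivity)]
    have b1 : 0 ≤ p2 * (p0 - p3) ^ 2 := by positivity
    have b2 : 0 ≤ p0 * p3 * (p2 - p3) := mul_nonneg (by positivity) (by linarith)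
    have b3 : 0 ≤ p2 * (p1 ^ 2 - p3 ^ 2) := mul_nonneg hp2.le (by nlinarith)
    have b4 : 0 ≤ p2 * (p2 ^ 2 - p3 ^ 2) := mul_nonneg hp2.le (by nlinarith)
    nlinarith

/-- The case `i = 2`, at a fixed temperature. -/
lemma case2 {p0 p1 p2 p3 : ℝ} (hp0 : 0 < p0) (hp1 : 0 < p1) (hp2 : 0 < p2)
    (hp3 : 0 < p3) (h01 : p1 ≤ p0) (h12 : p2 ≤ p1) (h23 : p3 ≤ p2)
    (c3 : p1 * p2 ≤ p0 * p3) :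
    p0 * p2 / (2 * (p0 * p2 + p1 * p3)) ≤ p0 ^ 2 / (p0 ^ 2 + p1 ^ 2 + p2 ^ 2 + p3 ^ 2) ∧
    p0 * p2 / (2 * (p0 * p2 + p1 * p3)) + p0 * p2 / (2 * (p0 * p2 + p1 * p3)) ≤
      (p0 ^ 2 + p1 ^ 2) / (p0 ^ 2 + p1 ^ 2 + p2 ^ 2 + p3 ^ 2) ∧
    p3 ^ 2 / (p0 ^ 2 + p1 ^ 2 + p2 ^ 2 + p3 ^ 2) ≤ p1 * p3 / (2 * (p0 * p2 + p1 * p3)) := by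
  refine ⟨?_, ?_, ?_⟩
  · rw [div_le_div_iff₀ (by positivity) (by positivity)]
    have b1 : 0 ≤ p1 * (p0 * p3 - p1 * p2) := mul_nonneg hp1.le (by linarith)
    have b2 : 0 ≤ p3 * (p0 * p1 - p2 * p3) := mul_nonneg hp3.le (by nlinarith)
    have b3 : 0 ≤ p2 * (p0 ^ 2 - p2 ^ 2) := mul_nonneg hp2.le (by nlinarith)
    have : p2 * (p0 ^ 2 + p1 ^ 2 + p2 ^ 2 + p3 ^ 2) ≤ p0 * (2 * (p0 * p2 + p1 * p3)) := by
      nlinarith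
    nlinarith
  · have e : p0 * p2 / (2 * (p0 * p2 + p1 * p3)) + p0 * p2 / (2 * (p0 * p2 + p1 * p3))
        = p0 * p2 / (p0 * p2 + p1 * p3) := by field_simp; ring
    rw [e, div_le_div_iff₀ (by positivity) (by positivity)]
    -- key: (p2²+p3²) p0 p2 ≤ (p0²+p1²) p1 p3
    have b1 : (p2 ^ 2 + p3 ^ 2) * (p0 * p1) ≤ (p0 ^ 2 + p1 ^ 2) * (p2 * p3) := by
      have : 0 ≤ (p0 * p3 - p1 * p2) * (p0 * p2 - p1 * p3) :=
        mul_nonneg (by linarith) (by nlinarith)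
      nlinarith
    have b2 : (p2 ^ 2 + p3 ^ 2) * (p0 * p2) * p2 ≤ (p0 ^ 2 + p1 ^ 2) * (p1 * p3) * p2 := by
      have m := mul_le_mul_of_nonneg_left b1 hp1.le
      have : 0 ≤ (p2 ^ 2 + p3 ^ 2) * p0 * (p1 ^ 2 - p2 ^ 2) :=
        mul_nonneg (by positivity) (by nlinarith)
      nlinarith
    have b3 := le_of_mul_le_mul_right b2 hp2
    nlinarith
  · rw [div_le_div_iff₀ (by positivity) (by positivity)]
    have b1 : 0 ≤ p1 * (p0 - p2) ^ 2 := by positivity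
    have b2 : 0 ≤ p0 * p2 * (p1 - p3) := mul_nonneg (by positivity) (by linarith)
    have b3 : 0 ≤ p1 * (p1 ^ 2 - p3 ^ 2) := mul_nonneg hp1.le (by nlinarith)
    have : p3 * (2 * (p0 * p2 + p1 * p3)) ≤ p1 * (p0 ^ 2 + p1 ^ 2 + p2 ^ 2 + p3 ^ 2) := by
      nlinarith
    nlinarith

/-- The norm inequality for `i = 1`. -/
lemma norm1 {p0 p1 p2 p3 q0 q1 q2 q3 : ℝ} (hp0 : 0 < p0) (hp1 : 0 < p1) (hp2 : 0 < p2)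
    (hp3 : 0 < p3) (hq0 : 0 < q0) (hq1 : 0 < q1) (hq2 : 0 < q2) (hq3 : 0 < q3)
    (h01 : p1 ≤ p0) (h12 : p2 ≤ p1) (h23 : p3 ≤ p2) (g12 : q2 ≤ q1)
    (hp : p0 + p1 + p2 + p3 = 1) (hq : q0 + q1 + q2 + q3 = 1)
    (k01 : q1 * p0 ≤ q0 * p1) (k13 : q3 * p1 ≤ q1 * p3)
    (k : q1 ^ 2 * (p0 * p2) ≤ p1 ^ 2 * (q0 * q2)) :
    (q0 + q2) * (q1 + q3) ≤ (p0 + p2) * (p1 + p3) := by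
  have key : (p0 + p2) * (q1 + q3) ≤ (q0 + q2) * (p1 + p3) := by
    -- q1 (p0+p2) ≤ p1 (q0+q2)
    have s1 : q1 * (p0 + p2) ≤ p1 * (q0 + q2) := by
      have u : 0 ≤ q0 * p1 - q1 * p0 := by linarith
      have t1 : p0 * q1 * (q1 * p2 - p1 * q2) ≤ p1 * q2 * (q0 * p1 - q1 * p0) := by
        linarith
      have t2 : p1 * q2 ≤ p0 * q1 := mul_le_mul h01 g12 hq2.le hp0.le
      have t3 := t1.trans (mul_le_mul_of_nonneg_right t2 u)
      have := le_of_mul_le_mul_left t3 (by positivity)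
      linarith
    have s2 : p1 * (q1 + q3) ≤ q1 * (p1 + p3) := by linarith
    have s3 := mul_le_mul s1 s2 (by positivity) (by positivity)
    have : p1 * q1 * ((p0 + p2) * (q1 + q3)) ≤ p1 * q1 * ((q0 + q2) * (p1 + p3)) := by
      linarith
    exact le_of_mul_le_mul_left this (by positivity)
  have e1 : p1 + p3 = 1 - (p0 + p2) := by linarith
  have e2 : q1 + q3 = 1 - (q0 + q2) := by linarith
  have hs : 1 / 2 ≤ p0 + p2 := by linarith
  rw [e1, e2] at key ⊢
  have hst : p0 + p2 ≤ q0 + q2 := by linarith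
  have := mul_nonneg (sub_nonneg.2 hst) (show 0 ≤ (q0 + q2) + (p0 + p2) - 1 by linarith)
  linarith

lemma norm2_ineq {a b c A B C : ℝ} (ha : 0 < a) (hab : a ≤ b) (hbc : b ≤ c) (hc : c ≤ 1)
    (hC : 0 ≤ C) (hCB : C ≤ B) (hBA : B ≤ A) :
    2 * (1 + a * c) * (a * A + a * b * (A + B) + a * b * c * (A + B + C)) ≤
    (1 + a + a * b + a * b * c) * ((A + B) + a * c * (2 * A + B + C)) := by
  have hb : 0 < b := by linarith
  have hc0 : 0 < c := by linarith
  have hbc1 : b * c ≤ 1 := by nlinarith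
  have ha1 : a ≤ 1 := by linarith
  have hb1 : b ≤ 1 := by linarith
  have T1 : 0 ≤ 1 + a - a * b - a * b * c := by nlinarith
  have TA : 0 ≤ 1 + 2 * (a * c) - a - a * b - a * b * c := by nlinarith [mul_pos ha hb]
  have T12 : 0 ≤ (1 + a - a * b - a * b * c) + (1 + a + a * b - 2 * b - a * b * c) := by
    nlinarith
  have hac : 0 < a * c := by positivity
  have m1 := mul_nonneg TA (show 0 ≤ A by linarith)
  have m2 := mul_nonneg (mul_nonneg (show 0 ≤ 1 + a * c by positivity) T1)
    (sub_nonneg.2 hCB)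
  have m3 := mul_nonneg (add_nonneg T1 (mul_nonneg hac.le T12)) hC
  nlinarith

lemma gibbs_pos (E : Fin 4 → ℝ) (β : ℝ) (j : Fin 4) : 0 < gibbs E β j := by
  unfold gibbs
  have : 0 < ∑ j, Real.exp (-(β * E j)) :=
    Finset.sum_pos (fun _ _ => Real.exp_pos _) Finset.univ_nonempty
  positivity

lemma gibbs_sum (E : Fin 4 → ℝ) (β : ℝ) :
    gibbs E β 0 + gibbs E β 1 + gibbs E β 2 + gibbs E β 3 = 1 := by
  have h : 0 < ∑ j, Real.exp (-(β * E j)) :=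
    Finset.sum_pos (fun _ _ => Real.exp_pos _) Finset.univ_nonempty
  have : ∑ j, gibbs E β j = 1 := by
    unfold gibbs
    rw [← Finset.sum_div, div_self h.ne']
  simpa [Fin.sum_univ_four] using this

lemma gibbs_eq (E : Fin 4 → ℝ) (β : ℝ) : ∃ c : ℝ, 0 < c ∧
    ∀ j, gibbs E β j = c * Real.exp (-(β * E j)) := by
  have h : 0 < ∑ j, Real.exp (-(β * E j)) :=
    Finset.sum_pos (fun _ _ => Real.exp_pos _) Finset.univ_nonempty
  exact ⟨(∑ j, Real.exp (-(β * E j)))⁻¹, by positivity, fun j => by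
    unfold gibbs; rw [div_eq_inv_mul]⟩

lemma gibbs_anti (E : Fin 4 → ℝ) {β : ℝ} (hβ : 0 ≤ β) {j l : Fin 4} (h : E j ≤ E l) :
    gibbs E β l ≤ gibbs E β j := by
  obtain ⟨c, hc, e⟩ := gibbs_eq E β
  rw [e, e]
  have := mul_le_mul_of_nonneg_left h hβ
  gcongr

lemma gibbs_two (E : Fin 4 → ℝ) {β : ℝ} (hβ : 0 ≤ β) {j l m n : Fin 4}
    (h : E m + E n ≤ E j + E l) :
    gibbs E β j * gibbs E β l ≤ gibbs E β m * gibbs E β n := by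
  obtain ⟨c, hc, e⟩ := gibbs_eq E β
  have h1 := mul_le_mul_of_nonneg_left h hβ
  have h2 : Real.exp (-(β * E j)) * Real.exp (-(β * E l)) ≤
      Real.exp (-(β * E m)) * Real.exp (-(β * E n)) := by
    rw [← Real.exp_add, ← Real.exp_add, Real.exp_le_exp]
    linarith
  rw [e, e, e, e]
  have := mul_le_mul_of_nonneg_left h2 (show 0 ≤ c * c by positivity)
  linarith

lemma gibbs_cross (E : Fin 4 → ℝ) {β β' : ℝ} (hβ : β' ≤ β) {j l : Fin 4} (h : E j ≤ E l) :
    gibbs E β l * gibbs E β' j ≤ gibbs E β j * gibbs E β' l := by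
  obtain ⟨c, hc, e⟩ := gibbs_eq E β
  obtain ⟨c', hc', e'⟩ := gibbs_eq E β'
  have h1 := mul_nonneg (sub_nonneg.2 h) (sub_nonneg.2 hβ)
  have h2 : Real.exp (-(β * E l)) * Real.exp (-(β' * E j)) ≤
      Real.exp (-(β * E j)) * Real.exp (-(β' * E l)) := by
    rw [← Real.exp_add, ← Real.exp_add, Real.exp_le_exp]
    linarith
  rw [e, e, e', e']
  have := mul_le_mul_of_nonneg_left h2 (show 0 ≤ c * c' by positivity)
  linarith

lemma gibbs_cross2 (E : Fin 4 → ℝ) {β β' : ℝ} (hβ : β' ≤ β)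
    (h : E 2 - E 1 ≤ E 1 - E 0) :
    gibbs E β 1 ^ 2 * (gibbs E β' 0 * gibbs E β' 2) ≤
      gibbs E β' 1 ^ 2 * (gibbs E β 0 * gibbs E β 2) := by
  obtain ⟨c, hc, e⟩ := gibbs_eq E β
  obtain ⟨c', hc', e'⟩ := gibbs_eq E β'
  have h1 := mul_nonneg (sub_nonneg.2 h) (sub_nonneg.2 hβ)
  have h2 : Real.exp (-(β * E 1)) ^ 2 * (Real.exp (-(β' * E 0)) * Real.exp (-(β' * E 2))) ≤
      Real.exp (-(β' * E 1)) ^ 2 * (Real.exp (-(β * E 0)) * Real.exp (-(β * E 2))) := by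
    rw [sq, sq, ← Real.exp_add, ← Real.exp_add, ← Real.exp_add, ← Real.exp_add,
      ← Real.exp_add, ← Real.exp_add, Real.exp_le_exp]
    linarith
  simp only [e, e']
  have := mul_le_mul_of_nonneg_left h2 (show 0 ≤ c ^ 2 * c' ^ 2 by positivity)
  linarith

/-- The derivative inequality, in terms of Boltzmann weights. -/
lemma norm2_weights {E0 E1 E2 E3 e0 e1 e2 e3 : ℝ} (h0 : 0 < e0) (h1 : 0 < e1) (h2 : 0 < e2)
    (h3 : 0 < e3) (h32 : e3 ≤ e2) (c1 : e1 ^ 2 ≤ e0 * e2) (c2 : e2 ^ 2 ≤ e1 * e3)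
    (hC : E2 ≤ E3) (hCB : E3 - E2 ≤ E2 - E1) (hBA : E2 - E1 ≤ E1 - E0) :
    2 * (e0 * e2 + e1 * e3) * (E0 * e0 + E1 * e1 + E2 * e2 + E3 * e3) ≤
    (e0 + e1 + e2 + e3) * ((E0 + E2) * (e0 * e2) + (E1 + E3) * (e1 * e3)) := by
  obtain ⟨a, rfl⟩ : ∃ a, e1 = e0 * a := ⟨e1 / e0, by field_simp⟩
  obtain ⟨b, rfl⟩ : ∃ b, e2 = e0 * a * b := ⟨e2 / (e0 * a), (mul_div_cancel₀ _ h1.ne').symm⟩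
  obtain ⟨c, rfl⟩ : ∃ c, e3 = e0 * a * b * c := ⟨e3 / (e0 * a * b), (mul_div_cancel₀ _ h2.ne').symm⟩
  have ha : 0 < a := pos_of_mul_pos_right h1 h0.le
  have hb : 0 < b := pos_of_mul_pos_right h2 h1.le
  have hab : a ≤ b := by
    have : e0 ^ 2 * a * a ≤ e0 ^ 2 * a * b := by linarith
    exact le_of_mul_le_mul_left this (by positivity)
  have hbc : b ≤ c := by
    have : (e0 * a) ^ 2 * b * b ≤ (e0 * a) ^ 2 * b * c := by linarith
    exact le_of_mul_le_mul_left this (by positivity)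
  have hc : c ≤ 1 := by
    have : e0 * a * b * c ≤ e0 * a * b * 1 := by linarith
    exact le_of_mul_le_mul_left this (by positivity)
  have key := norm2_ineq (A := E1 - E0) (B := E2 - E1) (C := E3 - E2) ha hab hbc hc
    (by linarith) hCB hBA
  have := mul_le_mul_of_nonneg_left key (show 0 ≤ e0 ^ 3 * a * b by positivity)
  linarith

lemma norm2_anti (E : Fin 4 → ℝ) (hE : Monotone E)
    (hgap1 : E 2 - E 1 ≤ E 1 - E 0) (hgap2 : E 3 - E 2 ≤ E 2 - E 1) :
    AntitoneOn (fun β : ℝ => (Real.exp (-(β * E 0)) * Real.exp (-(β * E 2)) +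
      Real.exp (-(β * E 1)) * Real.exp (-(β * E 3))) /
      (Real.exp (-(β * E 0)) + Real.exp (-(β * E 1)) + Real.exp (-(β * E 2)) +
        Real.exp (-(β * E 3))) ^ 2) (Set.Ici 0) := by
  have hd : ∀ (x β : ℝ), HasDerivAt (fun β : ℝ => Real.exp (-(β * x)))
      (Real.exp (-(β * x)) * (-x)) β := by
    intro x β
    have := (((hasDerivAt_id β).mul_const x).neg).exp
    simpa using this
  have hD := fun β : ℝ => ((((hd (E 0) β).mul (hd (E 2) β)).add
    ((hd (E 1) β).mul (hd (E 3) β))).div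
    (((((hd (E 0) β).add (hd (E 1) β)).add (hd (E 2) β)).add (hd (E 3) β)).pow 2)
    (by simp only [Pi.add_apply, Pi.pow_apply]; positivity))
  refine antitoneOn_of_hasDerivWithinAt_nonpos (convex_Ici 0)
    (fun β _ => (hD β).continuousAt.continuousWithinAt)
    (fun β _ => (hD β).hasDerivWithinAt) ?_
  intro β hβ
  rw [interior_Ici] at hβ
  have hβ0 : 0 ≤ β := le_of_lt hβ
  simp only [Pi.add_apply, Pi.pow_apply, Pi.mul_apply]
  apply div_nonpos_of_nonpos_of_nonneg _ (by positivity)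
  have h32 : Real.exp (-(β * E 3)) ≤ Real.exp (-(β * E 2)) := by
    have := mul_le_mul_of_nonneg_left (hE (show (2 : Fin 4) ≤ 3 by decide)) hβ0
    gcongr
  have c1 : Real.exp (-(β * E 1)) ^ 2 ≤ Real.exp (-(β * E 0)) * Real.exp (-(β * E 2)) := by
    rw [sq, ← Real.exp_add, ← Real.exp_add, Real.exp_le_exp]
    have := mul_nonneg hβ0 (sub_nonneg.2 hgap1)
    linarith
  have c2 : Real.exp (-(β * E 2)) ^ 2 ≤ Real.exp (-(β * E 1)) * Real.exp (-(β * E 3)) := by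
    rw [sq, ← Real.exp_add, ← Real.exp_add, Real.exp_le_exp]
    have := mul_nonneg hβ0 (sub_nonneg.2 hgap2)
    linarith
  have key := norm2_weights (Real.exp_pos _) (Real.exp_pos _) (Real.exp_pos _)
    (Real.exp_pos _) h32 c1 c2 (hE (show (2 : Fin 4) ≤ 3 by decide)) hgap2 hgap1
  generalize he0 : Real.exp (-(β * E 0)) = e0 at *
  generalize he1 : Real.exp (-(β * E 1)) = e1 at *
  generalize he2 : Real.exp (-(β * E 2)) = e2 at *
  generalize he3 : Real.exp (-(β * E 3)) = e3 at *
  have hs : 0 ≤ e0 + e1 + e2 + e3 := by rw [← he0, ← he1, ← he2, ← he3]; positivity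
  have := mul_le_mul_of_nonneg_left key hs
  norm_num
  linarith

lemma cyc_one_apply (v : Fin 4 → ℝ) (j : Fin 4) :
    (1 + cyc 4 ^ 1).mulVec v j = v j + v (j - 1) := by
  rw [pow_one, Matrix.add_mulVec, Matrix.one_mulVec]
  fin_cases j <;> simp [cyc, Matrix.mulVec, dotProduct, Fin.sum_univ_four] <;> rfl

lemma cyc_apply (v : Fin 4 → ℝ) (j : Fin 4) : (cyc 4).mulVec v j = v (j - 1) := by
  fin_cases j <;> simp [cyc, Matrix.mulVec, dotProduct, Fin.sum_univ_four] <;> rfl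

lemma cyc_two_apply (v : Fin 4 → ℝ) (j : Fin 4) :
    (1 + cyc 4 ^ 2).mulVec v j = v j + v (j - 2) := by
  rw [pow_two, Matrix.add_mulVec, Matrix.one_mulVec, ← Matrix.mulVec_mulVec, Pi.add_apply,
    cyc_apply, cyc_apply]
  fin_cases j <;> rfl


theorem passing_norm_dim4
    (E : Fin 4 → ℝ) (hE : Monotone E)
    (hgap1 : E 2 - E 1 ≤ E 1 - E 0) (hgap2 : E 3 - E 2 ≤ E 2 - E 1)
    (β' β : ℝ) (hβ' : 0 ≤ β') (hββ : β' ≤ β)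
    (i : Fin 4) (hi : i = 1 ∨ i = 2) :
    IsMajorizedBy
      (fun j => (1 + cyc 4 ^ (i : ℕ)).mulVec
          (fun l => gibbs E β' l * gibbs E β' (l + i)) j /
        (2 * ∑ l, gibbs E β' l * gibbs E β' (l + i)))
      (fun j => gibbs E β j ^ 2 / ∑ l, gibbs E β l ^ 2) ∧
    (∑ l, gibbs E β l * gibbs E β (l + i)) ≤
      ∑ l, gibbs E β' l * gibbs E β' (l + i) := by
  have hE01 : E 0 ≤ E 1 := hE (by decide)
  have hE12 : E 1 ≤ E 2 := hE (by decide)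
  have hE23 : E 2 ≤ E 3 := hE (by decide)
  have hβ : 0 ≤ β := hβ'.trans hββ
  have hS := sq_step (gibbs_pos E β' 0) (gibbs_pos E β' 1) (gibbs_pos E β' 2)
    (gibbs_pos E β' 3) (gibbs_pos E β 0) (gibbs_pos E β 1) (gibbs_pos E β 2)
    (gibbs_pos E β 3) (gibbs_cross E hββ hE01) (gibbs_cross E hββ (hE01.trans hE12))
    (gibbs_cross E hββ (hE01.trans (hE12.trans hE23))) (gibbs_cross E hββ hE12)
    (gibbs_cross E hββ (hE12.trans hE23)) (gibbs_cross E hββ hE23)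
  have c1 : gibbs E β' 1 ^ 2 ≤ gibbs E β' 0 * gibbs E β' 2 := by
    rw [sq]; exact gibbs_two E hβ' (by linarith)
  have c3 : gibbs E β' 1 * gibbs E β' 2 ≤ gibbs E β' 0 * gibbs E β' 3 :=
    gibbs_two E hβ' (by linarith)
  have hp01 := gibbs_anti E hβ' hE01
  have hp12 := gibbs_anti E hβ' hE12
  have hp23 := gibbs_anti E hβ' hE23
  have hq12 := gibbs_anti E hβ hE12
  have hN1 := norm1 (gibbs_pos E β' 0) (gibbs_pos E β' 1) (gibbs_pos E β' 2)
    (gibbs_pos E β' 3) (gibbs_pos E β 0) (gibbs_pos E β 1) (gibbs_pos E β 2)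
    (gibbs_pos E β 3) hp01 hp12 hp23 hq12 (gibbs_sum E β') (gibbs_sum E β)
    (gibbs_cross E hββ hE01) (gibbs_cross E hββ (hE12.trans hE23))
    (gibbs_cross2 E hββ hgap1)
  have hC1 := case1 (gibbs_pos E β' 0) (gibbs_pos E β' 1) (gibbs_pos E β' 2)
    (gibbs_pos E β' 3) hp01 hp12 hp23 c1 c3
  have hC2 := case2 (gibbs_pos E β' 0) (gibbs_pos E β' 1) (gibbs_pos E β' 2)
    (gibbs_pos E β' 3) hp01 hp12 hp23 c3
  have hN2 : gibbs E β 0 * gibbs E β 2 + gibbs E β 1 * gibbs E β 3 ≤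
      gibbs E β' 0 * gibbs E β' 2 + gibbs E β' 1 * gibbs E β' 3 := by
    have h := norm2_anti E hE hgap1 hgap2 (Set.mem_Ici.2 hβ') (Set.mem_Ici.2 hβ) hββ
    simp only at h
    have e : ∀ γ, gibbs E γ 0 * gibbs E γ 2 + gibbs E γ 1 * gibbs E γ 3 =
        (Real.exp (-(γ * E 0)) * Real.exp (-(γ * E 2)) +
      Real.exp (-(γ * E 1)) * Real.exp (-(γ * E 3))) /
      (Real.exp (-(γ * E 0)) + Real.exp (-(γ * E 1)) + Real.exp (-(γ * E 2)) +
        Real.exp (-(γ * E 3))) ^ 2 := by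
      intro γ
      simp only [gibbs, Fin.sum_univ_four]
      field_simp
    rw [e, e]
    exact h
  have P0 := gibbs_pos E β' 0
  have P1 := gibbs_pos E β' 1
  have P2 := gibbs_pos E β' 2
  have P3 := gibbs_pos E β' 3
  have Q0 := gibbs_pos E β 0
  have Q1 := gibbs_pos E β 1
  have Q2 := gibbs_pos E β 2
  have Q3 := gibbs_pos E β 3
  generalize gibbs E β' = p at *
  generalize gibbs E β = q at *
  obtain ⟨hS1, hS2, hS3⟩ := hS
  have hwsum : ∑ j, q j ^ 2 / ∑ l, q l ^ 2 = 1 := by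
    rw [← Finset.sum_div]
    apply div_self
    rw [Fin.sum_univ_four]
    positivity
  rcases hi with rfl | rfl
  · have hsum : ∀ r : Fin 4 → ℝ, ∑ l, r l * r (l + 1) = (r 0 + r 2) * (r 1 + r 3) := by
      intro r
      rw [Fin.sum_univ_four]
      change r 0 * r 1 + r 1 * r 2 + r 2 * r 3 + r 3 * r 0 = _
      ring
    refine ⟨?_, by rw [hsum, hsum]; exact hN1⟩
    have hv : (fun j => (1 + cyc 4 ^ ((1 : Fin 4) : ℕ)).mulVec
          (fun l => p l * p (l + 1)) j / (2 * ∑ l, p l * p (l + 1))) =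
        ![p 0 / (2 * (p 0 + p 2)), p 1 / (2 * (p 1 + p 3)), p 2 / (2 * (p 0 + p 2)),
          p 3 / (2 * (p 1 + p 3))] := by
      funext j
      rw [hsum]
      change (1 + cyc 4 ^ 1).mulVec (fun l => p l * p (l + 1)) j / _ = _
      rw [cyc_one_apply]
      fin_cases j
      · change (p 0 * p 1 + p 3 * p 0) / _ = p 0 / (2 * (p 0 + p 2))
        field_simp
      · change (p 1 * p 2 + p 0 * p 1) / _ = p 1 / (2 * (p 1 + p 3))
        field_simp; try ring
      · change (p 2 * p 3 + p 1 * p 2) / _ = p 2 / (2 * (p 0 + p 2))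
        field_simp; try ring
      · change (p 3 * p 0 + p 2 * p 3) / _ = p 3 / (2 * (p 1 + p 3))
        field_simp; try ring
    rw [hv]
    obtain ⟨A1, A2, A3⟩ := hC1
    have o1 : p 1 / (2 * (p 1 + p 3)) ≤ p 0 / (2 * (p 0 + p 2)) := by
      rw [div_le_div_iff₀ (by positivity) (by positivity)]; linarith
    have o2 : p 3 / (2 * (p 1 + p 3)) ≤ p 1 / (2 * (p 1 + p 3)) := by
      gcongr; linarith
    have o3 : p 2 / (2 * (p 0 + p 2)) ≤ p 3 / (2 * (p 1 + p 3)) := by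
      rw [div_le_div_iff₀ (by positivity) (by positivity)]; linarith
    have tot : p 0 / (2 * (p 0 + p 2)) + p 1 / (2 * (p 1 + p 3)) + p 2 / (2 * (p 0 + p 2)) +
          p 3 / (2 * (p 1 + p 3)) = 1 := by field_simp; ring
    generalize p 0 / (2 * (p 0 + p 2)) = v0 at *
    generalize p 1 / (2 * (p 1 + p 3)) = v1 at *
    generalize p 2 / (2 * (p 0 + p 2)) = v2 at *
    generalize p 3 / (2 * (p 1 + p 3)) = v3 at *
    have A1' := A1.trans hS1
    have A2' := A2.trans hS2
    have A3' := hS3.trans A3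
    rw [add_div] at A2'
    apply maj_of
    · rw [Fin.sum_univ_four]
      intro j; fin_cases j <;> simp <;> linarith
    · rw [Fin.sum_univ_four]
      intro j l hjl; fin_cases j <;> fin_cases l <;> simp at hjl ⊢ <;> linarith
    · rw [Fin.sum_univ_four]
      intro j; fin_cases j <;> simp <;> linarith
    · rw [hwsum, Fin.sum_univ_four]
      simpa using tot
  · have hsum : ∀ r : Fin 4 → ℝ, ∑ l, r l * r (l + 2) = 2 * (r 0 * r 2 + r 1 * r 3) := by
      intro r
      rw [Fin.sum_univ_four]
      change r 0 * r 2 + r 1 * r 3 + r 2 * r 0 + r 3 * r 1 = _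
      ring
    refine ⟨?_, by rw [hsum, hsum]; linarith⟩
    have hv : (fun j => (1 + cyc 4 ^ ((2 : Fin 4) : ℕ)).mulVec
          (fun l => p l * p (l + 2)) j / (2 * ∑ l, p l * p (l + 2))) =
        ![p 0 * p 2 / (2 * (p 0 * p 2 + p 1 * p 3)), p 1 * p 3 / (2 * (p 0 * p 2 + p 1 * p 3)),
          p 0 * p 2 / (2 * (p 0 * p 2 + p 1 * p 3)),
          p 1 * p 3 / (2 * (p 0 * p 2 + p 1 * p 3))] := by
      funext j
      rw [hsum]
      change (1 + cyc 4 ^ 2).mulVec (fun l => p l * p (l + 2)) j / _ = _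
      rw [cyc_two_apply]
      fin_cases j
      · change (p 0 * p 2 + p 2 * p 0) / _ = p 0 * p 2 / (2 * (p 0 * p 2 + p 1 * p 3))
        field_simp; try ring
      · change (p 1 * p 3 + p 3 * p 1) / _ = p 1 * p 3 / (2 * (p 0 * p 2 + p 1 * p 3))
        field_simp; try ring
      · change (p 2 * p 0 + p 0 * p 2) / _ = p 0 * p 2 / (2 * (p 0 * p 2 + p 1 * p 3))
        field_simp; try ring
      · change (p 3 * p 1 + p 1 * p 3) / _ = p 1 * p 3 / (2 * (p 0 * p 2 + p 1 * p 3))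
        field_simp; try ring
    rw [hv]
    obtain ⟨A1, A2, A3⟩ := hC2
    have o1 : p 1 * p 3 / (2 * (p 0 * p 2 + p 1 * p 3)) ≤
        p 0 * p 2 / (2 * (p 0 * p 2 + p 1 * p 3)) := by
      have : p 1 * p 3 ≤ p 0 * p 2 := mul_le_mul hp01 hp23 P3.le P0.le
      gcongr
    have tot : p 0 * p 2 / (2 * (p 0 * p 2 + p 1 * p 3)) +
        p 1 * p 3 / (2 * (p 0 * p 2 + p 1 * p 3)) +
        p 0 * p 2 / (2 * (p 0 * p 2 + p 1 * p 3)) +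
          p 1 * p 3 / (2 * (p 0 * p 2 + p 1 * p 3)) = 1 := by field_simp; ring
    generalize p 0 * p 2 / (2 * (p 0 * p 2 + p 1 * p 3)) = v0 at *
    generalize p 1 * p 3 / (2 * (p 0 * p 2 + p 1 * p 3)) = v1 at *
    have A1' := A1.trans hS1
    have A2' := A2.trans hS2
    have A3' := hS3.trans A3
    rw [add_div] at A2'
    apply maj_of
    · rw [Fin.sum_univ_four]
      intro j; fin_cases j <;> simp <;> linarith
    · rw [Fin.sum_univ_four]
      intro j l hjl; fin_cases j <;> fin_cases l <;> simp at hjl ⊢ <;> linarith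
    · rw [Fin.sum_univ_four]
      intro j; fin_cases j <;> simp <;> linarith
    · rw [hwsum, Fin.sum_univ_four]
      simpa using tot
end
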